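/- Fix an integer L ≥ 3 and a real λ with 0 ≤ λ < 1. For each n, let u₁, …, u_n be i.i.d. uniform on {0, …, L−1}, let n_ℓ = #{j : u_j = ℓ}, and set S_L = ((L−1)/2) Σ_{ℓ=0}^{L−1} n_ℓ² − (1/2) Σ_{j≠k} n_j n_k. Then for every function D : ℕ → ℕ with D(n)³/n → 0 as n → ∞, sup_n Σ_{d=0}^{D(n)} (λ^{2d} / (n^d d!)) · E[S_L^d] < ∞. -/

import Mathlib

open MeasureTheory Filter

/-- Number of coordinates of `u : Fin n → Fin L` equal to `ℓ`. -/
def cntL (L n : ℕ) (u : Fin n → Fin L) (ℓ : ℕ) : ℕ :=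
  (Finset.univ.filter fun j => (u j : ℕ) = ℓ).card

/-- `S_L = ((L-1)/2) ∑_ℓ n_ℓ² − (1/2) ∑_{j≠k} n_j n_k` for the counts of `u`. -/
noncomputable def SL (L n : ℕ) (u : Fin n → Fin L) : ℝ :=
  ((L : ℝ) - 1) / 2 * ∑ ℓ ∈ Finset.range L, (cntL L n u ℓ : ℝ) ^ 2
    - 1 / 2 * ∑ j ∈ Finset.range L, ∑ k ∈ Finset.range L,
        (if j ≠ k then (cntL L n u j : ℝ) * (cntL L n u k : ℝ) else 0)

lemma aux_exp {η z : ℝ} (hη : η ≤ 1) (hz : |z| ≤ η) :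
    Real.exp z ≤ 1 + z + (1 + η) / 2 * z ^ 2 := by
  have h := Real.exp_bound (x := z) (hz.trans hη) (n := 3) (by norm_num)
  have h2 := (abs_le.mp h).2
  simp only [Finset.sum_range_succ, Finset.sum_range_zero, Nat.factorial] at h2
  norm_num at h2
  have h3 : |z| ^ 3 ≤ η * z ^ 2 := by
    have : |z| ^ 3 = |z| * z ^ 2 := by rw [← sq_abs z]; ring
    rw [this]
    exact mul_le_mul_of_nonneg_right hz (sq_nonneg z)
  have h4 : 0 ≤ η * z ^ 2 := mul_nonneg ((abs_nonneg z).trans hz) (sq_nonneg z)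
  nlinarith

noncomputable def Yv (L n : ℕ) (u : Fin n → Fin L) (i : Fin L) : ℝ :=
  (cntL L n u i : ℝ) - n / L

lemma cnt_lin (L n : ℕ) (u : Fin n → Fin L) (w : Fin L → ℝ) :
    ∑ i : Fin L, w i * (cntL L n u i : ℝ) = ∑ j : Fin n, w (u j) := by
  have h : ∀ i : Fin L, (cntL L n u i : ℝ) = ∑ j : Fin n, if u j = i then (1:ℝ) else 0 := by
    intro i
    simp [cntL, Fin.ext_iff]
  simp_rw [h, Finset.mul_sum]
  rw [Finset.sum_comm]
  simp

lemma cnt_sum (L n : ℕ) (u : Fin n → Fin L) :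
    ∑ i : Fin L, (cntL L n u i : ℝ) = n := by
  have := cnt_lin L n u (fun _ => 1)
  simpa using this

lemma SL_eq (L n : ℕ) (hL : 0 < L) (u : Fin n → Fin L) :
    SL L n u = (L : ℝ) / 2 * ∑ i : Fin L, Yv L n u i ^ 2 := by
  have h1 := cnt_sum L n u
  have hL' : (L : ℝ) ≠ 0 := by positivity
  unfold SL Yv
  simp only [Finset.sum_range]
  have h2 : ∀ j k : Fin L, (if (j : ℕ) ≠ k then (cntL L n u j : ℝ) * (cntL L n u k : ℝ) else 0)
      = (cntL L n u j : ℝ) * (cntL L n u k : ℝ) - if j = k then (cntL L n u j : ℝ) ^ 2 else 0 := by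
    intro j k
    by_cases h : j = k
    · subst h; simp; ring
    · have : (j : ℕ) ≠ k := fun h' => h (Fin.ext h')
      simp [h, this]
  simp_rw [h2, Finset.sum_sub_distrib, sub_sq, Finset.sum_add_distrib, Finset.sum_sub_distrib]
  rw [← Finset.sum_mul_sum, h1]
  rw [← Finset.sum_mul, ← Finset.mul_sum, h1]
  simp
  field_simp
  ring

lemma Yv_abs (L n : ℕ) (hL : 0 < L) (u : Fin n → Fin L) (i : Fin L) : |Yv L n u i| ≤ n := by
  unfold Yv
  have h1 : (cntL L n u i : ℝ) ≤ n := by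
    have : cntL L n u i ≤ n := by
      unfold cntL
      exact (Finset.card_filter_le _ _).trans (by simp)
    exact_mod_cast this
  have h0 : (0:ℝ) ≤ cntL L n u i := by positivity
  have h2 : (n : ℝ) / L ≤ n := div_le_self (by positivity) (by exact_mod_cast hL)
  have h3 : (0:ℝ) ≤ n / L := by positivity
  rw [abs_le]; constructor <;> linarith

lemma mgf (L n : ℕ) (hL : 0 < L) (μu : Measure (Fin L)) [IsProbabilityMeasure μu]
    (hμu : ∀ k, μu {k} = 1 / (L : ENNReal)) (η : ℝ) (hη : η ≤ 1)
    (w : Fin L → ℝ) (R : ℝ) (hR : ∀ i, |w i| ≤ R) (hRη : 2 * R ≤ η) :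
    ∫ u : Fin n → Fin L, Real.exp (∑ i, w i * Yv L n u i) ∂(Measure.pi fun _ => μu)
      ≤ Real.exp (n * ((1 + η) / 2 * ((∑ i, w i ^ 2) / L))) := by
  have hL' : (0 : ℝ) < L := by exact_mod_cast hL
  set m : ℝ := (∑ i, w i) / L with hm
  have hsum : ∑ i, w i = L * m := by rw [hm]; field_simp
  have e1 : ∀ u : Fin n → Fin L, Real.exp (∑ i, w i * Yv L n u i)
      = ∏ j : Fin n, Real.exp (w (u j) - m) := by
    intro u
    rw [← Real.exp_sum]
    congr 1
    rw [Finset.sum_sub_distrib, ← cnt_lin]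
    simp only [Yv, mul_sub, Finset.sum_sub_distrib]
    rw [← Finset.sum_mul, hsum]
    simp
    field_simp
  simp_rw [e1]
  rw [integral_fintype_prod_eq_prod (𝕜 := ℝ) (f := fun (_ : Fin n) (x : Fin L) => Real.exp (w x - m))]
  simp only [Finset.prod_const, Finset.card_univ, Fintype.card_fin]
  have e2 : ∫ x, Real.exp (w x - m) ∂μu = ∑ k : Fin L, (1 / (L:ℝ)) * Real.exp (w k - m) := by
    rw [integral_fintype (Integrable.of_finite)]
    simp [Measure.real, hμu]
  rw [e2]
  have hmR : |m| ≤ R := by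
    rw [hm, abs_div, abs_of_pos hL', div_le_iff₀ hL']
    calc |∑ i, w i| ≤ ∑ i, |w i| := Finset.abs_sum_le_sum_abs _ _
      _ ≤ ∑ i : Fin L, R := Finset.sum_le_sum fun i _ => hR i
      _ = R * L := by simp; ring
  have hη0 : 0 ≤ η := by
    have := (abs_nonneg m).trans hmR
    linarith
  have e3 : ∑ k : Fin L, (1 / (L:ℝ)) * Real.exp (w k - m)
      ≤ 1 + (1 + η) / 2 * ((∑ i, w i ^ 2) / L) := by
    calc _ ≤ ∑ k : Fin L, (1 / (L:ℝ)) * (1 + (w k - m) + (1 + η) / 2 * (w k - m) ^ 2) := by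
          refine Finset.sum_le_sum fun k _ => mul_le_mul_of_nonneg_left (aux_exp hη ?_) (by positivity)
          exact (abs_sub _ _).trans (by linarith [hR k])
      _ = 1 + (1 + η) / 2 * ((∑ i, w i ^ 2) / L - m ^ 2) := by
          rw [← Finset.mul_sum]
          simp_rw [sub_sq, Finset.sum_add_distrib, ← Finset.mul_sum, Finset.sum_add_distrib, Finset.sum_sub_distrib]
          rw [← Finset.sum_mul, ← Finset.mul_sum, hsum]
          simp
          field_simp
          ring
      _ ≤ _ := by
          have : 0 ≤ (1 + η) / 2 * m ^ 2 := by positivity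
          linarith
  rw [Real.exp_nat_mul]
  refine pow_le_pow_left₀ (Finset.sum_nonneg fun k _ => by positivity) (e3.trans ?_) n
  linarith [Real.add_one_le_exp ((1 + η) / 2 * ((∑ i, w i ^ 2) / L))]

lemma gauss_sum (c : ℝ) (hc : 0 < c) : ∃ B : ℝ, 0 ≤ B ∧ ∀ K : ℕ,
    ∑ k ∈ Finset.Icc (-(K:ℤ)) K, Real.exp (-c * (k:ℝ) ^ 2) ≤ B := by
  have hs : Summable (fun k : ℤ => Real.exp (-c * (k:ℝ) ^ 2)) := by
    have hn : Summable (fun k : ℕ => Real.exp (-c * (k:ℝ) ^ 2)) := by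
      refine Summable.of_nonneg_of_le (fun _ => by positivity) (fun k => ?_)
        (Real.summable_exp_nat_mul_iff.mpr (neg_lt_zero.mpr hc))
      apply Real.exp_le_exp.mpr
      have : (k:ℝ) ≤ (k:ℝ) ^ 2 := by
        exact_mod_cast Nat.le_self_pow (by norm_num) k
      nlinarith
    refine Summable.of_nat_of_neg ?_ ?_
    · simpa using hn
    · simpa using hn
  exact ⟨_, tsum_nonneg fun _ => by positivity, fun K => hs.sum_le_tsum _ fun _ _ => by positivity⟩

lemma trunc_exp (A r : ℝ) (hA : 0 ≤ A) (hr : 0 < r) (hr1 : r ≤ 1) (D : ℕ) :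
    ∑ d ∈ Finset.range (D + 1), A ^ d / d.factorial ≤ (r⁻¹) ^ D * Real.exp (r * A) := by
  have h := Real.sum_le_exp_of_nonneg (x := r * A) (by positivity) (D + 1)
  refine le_trans ?_ (mul_le_mul_of_nonneg_left h (by positivity))
  rw [Finset.mul_sum]
  refine Finset.sum_le_sum fun d hd => ?_
  have hd' : d ≤ D := by simpa [Nat.lt_succ_iff] using hd
  have h1 : 1 ≤ (r⁻¹) ^ D * r ^ d := by
    obtain ⟨e, rfl⟩ := Nat.exists_eq_add_of_le hd'
    have : (r⁻¹) ^ (d + e) * r ^ d = (r⁻¹) ^ e := by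
      rw [pow_add, mul_right_comm, ← mul_pow, inv_mul_cancel₀ hr.ne', one_pow, one_mul]
    rw [this]
    exact one_le_pow₀ ((one_le_inv₀ hr).mpr hr1)
  have h2 : 0 ≤ A ^ d / d.factorial := by positivity
  calc A ^ d / d.factorial = 1 * (A ^ d / d.factorial) := by ring
    _ ≤ ((r⁻¹) ^ D * r ^ d) * (A ^ d / d.factorial) := mul_le_mul_of_nonneg_right h1 h2
    _ = _ := by rw [mul_pow]; ring

/-- discretised Gaussian linearisation -/
lemma linearise (L K : ℕ) (y : Fin L → ℝ) (hy : ∀ i, |y i| + 1 / 2 ≤ K) :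
    Real.exp (∑ i, y i ^ 2 / 2) ≤ Real.exp (L / 8) *
      ∑ k ∈ Fintype.piFinset (fun _ : Fin L => Finset.Icc (-(K:ℤ)) K),
        Real.exp (∑ i, ((k i : ℝ) * y i - (k i : ℝ) ^ 2 / 2)) := by
  have hmem : (fun i => round (y i)) ∈ Fintype.piFinset (fun _ : Fin L => Finset.Icc (-(K:ℤ)) K) := by
    rw [Fintype.mem_piFinset]
    intro i
    have h1 := abs_sub_round (y i)
    rw [abs_le] at h1
    have h2 := hy i
    have h3 := neg_abs_le (y i)
    have h4 := le_abs_self (y i)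
    rw [Finset.mem_Icc]
    constructor
    · have : (-(K:ℝ)) ≤ (round (y i) : ℝ) := by linarith
      exact_mod_cast this
    · have : (round (y i) : ℝ) ≤ K := by linarith
      exact_mod_cast this
  refine le_trans ?_ (mul_le_mul_of_nonneg_left
    (Finset.single_le_sum (f := fun k : Fin L → ℤ => Real.exp (∑ i, ((k i : ℝ) * y i - (k i : ℝ) ^ 2 / 2)))
      (fun _ _ => by positivity) hmem) (by positivity))
  rw [← Real.exp_add]
  apply Real.exp_le_exp.mpr
  have : (L : ℝ) / 8 = ∑ i : Fin L, (1 / 8 : ℝ) := by simp; ring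
  rw [this, ← Finset.sum_add_distrib]
  refine Finset.sum_le_sum fun i _ => ?_
  have h1 := abs_sub_round (y i)
  have h2 : (y i - round (y i)) ^ 2 ≤ (1/2) ^ 2 := sq_le_sq' (by linarith [(abs_le.mp h1).1]) (abs_le.mp h1).2
  nlinarith

set_option maxHeartbeats 2000000 in
lemma bound_n (L n : ℕ) (hL : 0 < L) (hn : 0 < n) (μu : Measure (Fin L)) [IsProbabilityMeasure μu]
    (hμu : ∀ k, μu {k} = 1 / (L : ENNReal)) (lam η δ r B s : ℝ) (K D : ℕ)
    (hlam0 : 0 ≤ lam) (hlam1 : lam < 1) (hη : η ≤ 1)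
    (hB : ∀ K : ℕ, ∑ k ∈ Finset.Icc (-(K:ℤ)) K,
      Real.exp (-((1 - lam ^ 2 * (1 + η)) / 2) * (k:ℝ) ^ 2) ≤ B)
    (hs0 : 0 < s) (hs : s ^ 2 = L / n) (hK1 : 2 * (K * s) ≤ η) (hK2 : s * (δ * n) + 1 / 2 ≤ K)
    (hδ : 0 < δ) (hδη : δ ≤ η) (hr : 0 < r) (hr1 : r ≤ 1) (hrL : r * (L:ℝ) ^ 2 ≤ δ ^ 2 / 16)
    (hDr : D * Real.log (r⁻¹) ≤ n * (δ ^ 2 / 16)) :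
    ∑ d ∈ Finset.range (D + 1),
        lam ^ (2 * d) / ((n : ℝ) ^ d * d.factorial) *
          ∫ u : Fin n → Fin L, SL L n u ^ d ∂(Measure.pi fun _ => μu)
      ≤ Real.exp (L / 8) * B ^ L + 2 * L := by
  have hL' : (0 : ℝ) < L := by exact_mod_cast hL
  have hL1 : (1 : ℝ) ≤ L := by exact_mod_cast hL
  have hn' : (0 : ℝ) < n := by exact_mod_cast hn
  set P := Measure.pi (fun _ : Fin n => μu) with hP
  have hint : ∀ f : (Fin n → Fin L) → ℝ, Integrable f P := fun f => Integrable.of_finite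
  set box := Fintype.piFinset (fun _ : Fin L => Finset.Icc (-(K:ℤ)) K) with hbox
  set y : (Fin n → Fin L) → Fin L → ℝ := fun u i => lam * s * Yv L n u i with hy
  set T : (Fin n → Fin L) → ℝ := fun u =>
    ∑ d ∈ Finset.range (D + 1), (lam ^ 2 * (SL L n u / n)) ^ d / d.factorial with hT
  have hlhs : ∑ d ∈ Finset.range (D + 1),
        lam ^ (2 * d) / ((n : ℝ) ^ d * d.factorial) * ∫ u : Fin n → Fin L, SL L n u ^ d ∂P
      = ∫ u, T u ∂P := by
    rw [hT, integral_finsetSum _ (fun d _ => hint _)]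
    refine Finset.sum_congr rfl fun d _ => ?_
    rw [← integral_const_mul]
    congr 1
    funext u
    rw [mul_pow, div_pow, ← pow_mul]
    field_simp
  rw [hlhs]
  set F : (Fin n → Fin L) → ℝ := fun u => Real.exp (L / 8) * ∑ k ∈ box,
        Real.exp (∑ i, ((k i : ℝ) * y u i - (k i : ℝ) ^ 2 / 2)) with hF
  set M : ℝ := Real.exp (n * (δ ^ 2 / 8)) with hM
  set β : ℝ := δ / 2 with hβ
  set G : (Fin n → Fin L) → ℝ := fun u => M * ∑ i : Fin L,
      (Real.exp (-(β * (δ * n))) * Real.exp (β * Yv L n u i)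
        + Real.exp (-(β * (δ * n))) * Real.exp (-β * Yv L n u i)) with hG
  have hF0 : ∀ u, 0 ≤ F u := fun u => by rw [hF]; positivity
  have hG0 : ∀ u, 0 ≤ G u := fun u => by rw [hG]; positivity
  have hW : ∀ u, lam ^ 2 * (SL L n u / n) = ∑ i, y u i ^ 2 / 2 := by
    intro u
    rw [SL_eq L n hL]
    simp only [hy, mul_pow, hs]
    rw [← Finset.sum_div, ← Finset.mul_sum]
    field_simp
  have hpt : ∀ u, T u ≤ F u + G u := by
    intro u
    have hW0 : 0 ≤ lam ^ 2 * (SL L n u / n) := by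
      rw [hW]; positivity
    by_cases hcase : ∀ i, |Yv L n u i| ≤ δ * n
    · have h1 : T u ≤ F u := by
        refine (Real.sum_le_exp_of_nonneg hW0 _).trans ?_
        rw [hW]
        refine linearise L K (y u) fun i => ?_
        refine le_trans ?_ hK2
        have : |y u i| ≤ s * (δ * n) := by
          simp only [hy]
          rw [abs_mul, abs_mul, abs_of_nonneg hlam0, abs_of_pos hs0]
          have h3 := hcase i
          calc lam * s * |Yv L n u i| ≤ 1 * s * (δ * n) := by gcongr
            _ = _ := by ring
        linarith
      linarith [hG0 u]
    · push Not at hcase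
      obtain ⟨i, hi⟩ := hcase
      have h1 : T u ≤ M := by
        refine (trunc_exp _ r hW0 hr hr1 D).trans ?_
        have h2 : lam ^ 2 * (SL L n u / n) ≤ L ^ 2 * n := by
          have h3 : SL L n u ≤ L ^ 2 * n * n := by
            rw [SL_eq L n hL]
            have h4 : ∑ i : Fin L, Yv L n u i ^ 2 ≤ ∑ i : Fin L, (n:ℝ) ^ 2 :=
              Finset.sum_le_sum fun i _ => sq_le_sq.mpr (by
                rw [abs_of_pos hn']; exact Yv_abs L n hL u i)
            simp at h4
            have h5 : 0 ≤ (L:ℝ) ^ 2 * (n:ℝ)^2 := by positivity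
            calc (L:ℝ) / 2 * ∑ i : Fin L, Yv L n u i ^ 2 ≤ L / 2 * (L * n ^ 2) := by gcongr
              _ ≤ _ := by linarith
          have h6 : SL L n u / n ≤ L ^ 2 * n := by rwa [div_le_iff₀ hn']
          have h7 : lam ^ 2 ≤ 1 := pow_le_one₀ hlam0 hlam1.le
          have h8 : 0 ≤ SL L n u / n := by
            rw [SL_eq L n hL]; positivity
          nlinarith
        have h9 : (r⁻¹) ^ D = Real.exp (D * Real.log (r⁻¹)) := by
          rw [Real.exp_nat_mul, Real.exp_log (by positivity)]
        rw [h9, ← Real.exp_add, hM]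
        apply Real.exp_le_exp.mpr
        have h10 : r * (lam ^ 2 * (SL L n u / n)) ≤ r * (L ^ 2 * n) := by gcongr
        have h11 : r * L ^ 2 * n ≤ δ ^ 2 / 16 * n := by gcongr
        linarith
      have h2 : M ≤ G u := by
        have hMp : 0 < M := Real.exp_pos _
        refine le_mul_of_one_le_right hMp.le ?_
        refine le_trans ?_ (Finset.single_le_sum (f := fun i : Fin L =>
          (Real.exp (-(β * (δ * n))) * Real.exp (β * Yv L n u i)
          + Real.exp (-(β * (δ * n))) * Real.exp (-β * Yv L n u i)))
          (fun _ _ => by positivity) (Finset.mem_univ i))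
        simp only [← Real.exp_add]
        have hβ0 : 0 < β := by rw [hβ]; positivity
        rcases lt_abs.mp hi with h | h
        · have : 1 ≤ Real.exp (-(β * (δ * n)) + β * Yv L n u i) := by
            apply Real.one_le_exp
            nlinarith
          linarith [Real.exp_pos (-(β * (δ * n)) + -β * Yv L n u i)]
        · have : 1 ≤ Real.exp (-(β * (δ * n)) + -β * Yv L n u i) := by
            apply Real.one_le_exp
            nlinarith
          linarith [Real.exp_pos (-(β * (δ * n)) + β * Yv L n u i)]
      linarith [hF0 u]
  have hFi : ∫ u, F u ∂P ≤ Real.exp (L / 8) * B ^ L := by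
    rw [hF, integral_const_mul]
    refine mul_le_mul_of_nonneg_left ?_ (by positivity)
    rw [integral_finsetSum _ (fun d _ => hint _)]
    have hk : ∀ k ∈ box, ∫ u, Real.exp (∑ i, ((k i : ℝ) * y u i - (k i : ℝ) ^ 2 / 2)) ∂P
        ≤ ∏ i, Real.exp (-((1 - lam ^ 2 * (1 + η)) / 2) * (k i:ℝ) ^ 2) := by
      intro k hk
      have hkb : ∀ i, |(k i : ℝ)| ≤ K := by
        intro i
        have := Fintype.mem_piFinset.mp hk i
        rw [Finset.mem_Icc] at this
        rw [abs_le]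
        exact ⟨by exact_mod_cast this.1, by exact_mod_cast this.2⟩
      have h1 := mgf L n hL μu hμu η hη (fun i => (k i : ℝ) * (lam * s)) (K * s)
        (fun i => by
          rw [abs_mul, abs_mul, abs_of_nonneg hlam0, abs_of_pos hs0]
          have := hkb i
          calc |(k i : ℝ)| * (lam * s) ≤ K * (1 * s) := by gcongr
            _ = _ := by ring) hK1
      have h2 : ∀ u, Real.exp (∑ i, ((k i : ℝ) * y u i - (k i : ℝ) ^ 2 / 2))
          = Real.exp (-∑ i, (k i : ℝ) ^ 2 / 2) * Real.exp (∑ i, (k i : ℝ) * (lam * s) * Yv L n u i) := by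
        intro u
        rw [← Real.exp_add, Finset.sum_sub_distrib]
        congr 1
        simp only [hy, mul_assoc]
        ring
      simp_rw [h2]
      rw [integral_const_mul]
      refine (mul_le_mul_of_nonneg_left h1 (by positivity)).trans (le_of_eq ?_)
      rw [← Real.exp_add, ← Real.exp_sum]
      congr 1
      simp only [mul_pow, hs]
      rw [← Finset.sum_mul, ← Finset.mul_sum, ← Finset.sum_div]
      field_simp
      ring
    refine (Finset.sum_le_sum hk).trans ?_
    rw [hbox, ← Finset.prod_univ_sum (fun _ : Fin L => Finset.Icc (-(K:ℤ)) K)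
      (fun _ (k : ℤ) => Real.exp (-((1 - lam ^ 2 * (1 + η)) / 2) * (k:ℝ) ^ 2))]
    simp only [Finset.prod_const, Finset.card_univ, Fintype.card_fin]
    exact pow_le_pow_left₀ (Finset.sum_nonneg fun _ _ => by positivity) (hB K) L
  have hGi : ∫ u, G u ∂P ≤ 2 * L := by
    have hone : ∀ (b : ℝ), |b| = β → ∀ i : Fin L,
        ∫ u, Real.exp (b * Yv L n u i) ∂P ≤ Real.exp (n * β ^ 2) := by
      intro b hb i
      have h1 := mgf L n hL μu hμu η hη (fun j => if j = i then b else 0) β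
        (fun j => by
          by_cases h : j = i
          · simp [h, hb]
          · simp only [h, if_false, abs_zero]
            rw [hβ]; positivity) (by rw [hβ]; linarith)
      simp only [ite_mul, zero_mul, Finset.sum_ite_eq', Finset.mem_univ, if_true, ite_pow] at h1
      refine h1.trans (Real.exp_le_exp.mpr ?_)
      simp only [ne_eq, OfNat.ofNat_ne_zero, not_false_eq_true, zero_pow, Finset.sum_ite_eq',
        Finset.mem_univ, if_true]
      have hb2 : b ^ 2 = β ^ 2 := by rw [← sq_abs, hb]
      rw [hb2]
      refine mul_le_mul_of_nonneg_left ?_ hn'.le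
      have h3 : β ^ 2 / L ≤ β ^ 2 := div_le_self (sq_nonneg _) hL1
      have h4 : 0 ≤ β ^ 2 / L := by positivity
      have h5 : (1 + η) / 2 ≤ 1 := by linarith
      nlinarith
    have hβ0 : 0 < β := by rw [hβ]; positivity
    rw [hG, integral_const_mul, integral_finsetSum _ (fun d _ => hint _)]
    calc _ ≤ M * ∑ i : Fin L, (Real.exp (-(β * (δ * n))) * Real.exp (n * β ^ 2)
            + Real.exp (-(β * (δ * n))) * Real.exp (n * β ^ 2)) := by
          refine mul_le_mul_of_nonneg_left (Finset.sum_le_sum fun i _ => ?_) (Real.exp_pos _).le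
          rw [integral_add (hint _) (hint _), integral_const_mul, integral_const_mul]
          have h1 := hone β (abs_of_pos hβ0) i
          have h2 := hone (-β) (by rw [abs_neg, abs_of_pos hβ0]) i
          exact add_le_add (mul_le_mul_of_nonneg_left h1 (Real.exp_pos _).le)
            (mul_le_mul_of_nonneg_left h2 (Real.exp_pos _).le)
      _ = 2 * L * Real.exp (n * (δ ^ 2 / 8) + (-(β * (δ * n)) + n * β ^ 2)) := by
          rw [Real.exp_add, Real.exp_add, hM]
          simp
          ring
      _ ≤ 2 * L * 1 := by
          refine mul_le_mul_of_nonneg_left (Real.exp_le_one_iff.mpr ?_) (by positivity)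
          rw [hβ]
          have : 0 ≤ n * δ ^ 2 := by positivity
          nlinarith
      _ = _ := by ring
  calc ∫ u, T u ∂P ≤ ∫ u, (F u + G u) ∂P := integral_mono (hint _) (hint _) hpt
    _ = ∫ u, F u ∂P + ∫ u, G u ∂P := integral_add (hint _) (hint _)
    _ ≤ _ := add_le_add hFi hGi

/-- **Low-degree hardness for multi-frequency synchronization over a finite group
of order `L`.** For `0 ≤ λ < 1`, with `u₁,…,u_n` i.i.d. uniform on `{0,…,L−1}`
and any `D : ℕ → ℕ` with `D(n)³/n → 0`, the low-degree likelihood ratio second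
moments `∑_{d=0}^{D(n)} (λ^{2d}/(n^d d!)) E[S_L^d]` are bounded uniformly in `n`. -/
theorem stmt14 (L : ℕ) (hL : 3 ≤ L) (lam : ℝ) (hlam0 : 0 ≤ lam) (hlam1 : lam < 1)
    (μu : Measure (Fin L)) [IsProbabilityMeasure μu]
    (hμu : ∀ k, μu {k} = 1 / (L : ENNReal))
    (D : ℕ → ℕ)
    (hD : Tendsto (fun n => (D n : ℝ) ^ 3 / n) atTop (nhds 0)) :
    ∃ C : ℝ, ∀ n : ℕ,
      ∑ d ∈ Finset.range (D n + 1),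
        lam ^ (2 * d) / ((n : ℝ) ^ d * d.factorial) *
          ∫ u : Fin n → Fin L, SL L n u ^ d ∂(Measure.pi fun _ => μu)
      ≤ C := by
  have hL0 : 0 < L := by omega
  have hL' : (0 : ℝ) < L := by exact_mod_cast hL0
  set η : ℝ := 1 - lam with hη
  have hη0 : 0 < η := by linarith
  have hη1 : η ≤ 1 := by linarith
  have hc : 0 < (1 - lam ^ 2 * (1 + η)) / 2 := by
    have : lam ^ 2 * (1 + η) < 1 := by
      have h1 : lam * (2 - lam) ≤ 1 := by nlinarith [sq_nonneg (1 - lam)]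
      have h2 : lam ^ 2 * (1 + η) = lam * (lam * (2 - lam)) := by rw [hη]; ring
      rw [h2]
      nlinarith
    linarith
  obtain ⟨B, -, hB⟩ := gauss_sum _ hc
  set δ : ℝ := η / (4 * L) with hδ
  have hδ0 : 0 < δ := by positivity
  have hL1 : (1 : ℝ) ≤ L := by exact_mod_cast hL0
  have hδη : δ ≤ η := div_le_self hη0.le (by linarith)
  set r : ℝ := min 1 (δ ^ 2 / 16 / L ^ 2) with hr
  have hr0 : 0 < r := lt_min one_pos (by positivity)
  have hr1 : r ≤ 1 := min_le_left _ _
  have hrL : r * (L:ℝ) ^ 2 ≤ δ ^ 2 / 16 := by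
    rw [← le_div_iff₀ (by positivity)]; exact min_le_right _ _
  have hlog : 0 ≤ Real.log (r⁻¹) := Real.log_nonneg ((one_le_inv₀ hr0).mpr hr1)
  have hev1 : ∀ᶠ n : ℕ in atTop, (D n : ℝ) ^ 3 / n < δ ^ 2 / 16 / (Real.log (r⁻¹) + 1) :=
    hD.eventually_lt_const (by positivity)
  have hev2 : ∀ᶠ n : ℕ in atTop, 36 * L / η ^ 2 ≤ (n : ℝ) :=
    tendsto_natCast_atTop_atTop.eventually_ge_atTop _
  obtain ⟨N, hN⟩ := eventually_atTop.mp (hev1.and (hev2.and (eventually_gt_atTop 0)))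
  set f : ℕ → ℝ := fun n => ∑ d ∈ Finset.range (D n + 1),
        lam ^ (2 * d) / ((n : ℝ) ^ d * d.factorial) *
          ∫ u : Fin n → Fin L, SL L n u ^ d ∂(Measure.pi fun _ => μu) with hf
  have hbig : ∀ n, N ≤ n → f n ≤ Real.exp (L / 8) * B ^ L + 2 * L := by
    intro n hn
    obtain ⟨h1, h2, h3⟩ := hN n hn
    have hn' : (0 : ℝ) < n := by exact_mod_cast h3
    set s : ℝ := Real.sqrt (L / n) with hs
    have hs0 : 0 < s := Real.sqrt_pos.mpr (by positivity)
    have hs2 : s ^ 2 = L / n := Real.sq_sqrt (by positivity)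
    have hs6 : s ≤ η / 6 := by
      refine abs_le_of_sq_le_sq' ?_ (by positivity) |>.2
      rw [hs2, div_le_iff₀ hn']
      rw [div_le_iff₀ (by positivity)] at h2
      linarith
    have hfl := Nat.floor_le (a := η / (2 * s)) (by positivity)
    have hfl2 := Nat.lt_floor_add_one (η / (2 * s))
    refine bound_n L n hL0 h3 μu hμu lam η δ r B s ⌊η / (2 * s)⌋₊ (D n) hlam0 hlam1 hη1 hB hs0 hs2
      ?_ ?_ hδ0 hδη hr0 hr1 hrL ?_
    · rw [le_div_iff₀ (by positivity)] at hfl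
      linarith
    · have h4 : s * (δ * n) = η / (4 * s) := by
        rw [hδ]
        have : (n : ℝ) = L / s ^ 2 := by rw [hs2]; field_simp
        rw [this]
        field_simp
      have h5 : η / (2 * s) = 2 * (η / (4 * s)) := by field_simp; norm_num
      have h6 : 3 / 2 ≤ η / (4 * s) := by
        rw [le_div_iff₀ (by positivity)]; linarith
      rw [h4]
      linarith
    · have h4 : (D n : ℝ) ≤ (D n : ℝ) ^ 3 := by
        exact_mod_cast Nat.le_self_pow (by norm_num) (D n)
      rw [div_lt_iff₀ hn', div_mul_eq_mul_div, lt_div_iff₀ (by positivity)] at h1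
      have h5 : (D n : ℝ) * Real.log (r⁻¹) ≤ (D n : ℝ) ^ 3 * (Real.log (r⁻¹) + 1) := by
        gcongr
        linarith
      linarith
  refine ⟨max (Real.exp (L / 8) * B ^ L + 2 * L) (∑ n ∈ Finset.range N, |f n|), fun n => ?_⟩
  rcases le_or_gt N n with h | h
  · exact (hbig n h).trans (le_max_left _ _)
  · refine le_trans ?_ (le_max_right _ _)
    exact (le_abs_self _).trans (Finset.single_le_sum (f := fun n => |f n|) (fun _ _ => abs_nonneg _) (Finset.mem_range.mpr h))
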